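/- arXiv:1407.1750 — 2 statements merged into one kernel-verified Lean document; each statement's English description precedes it below -/
import Mathlib

section
/- Let M and N be Lie superalgebras over a commutative unital ring K acting compatibly on each other. Then the canonical map M ⊗_K N → M ⊗ N, m ⊗ n ↦ m ⊗ n, is an even, surjective homomorphism of supermodules. Moreover, if M and N act trivially on each other, then M ⊗ N is an abelian Lie superalgebra and there is an isomorphism of supermodules M ⊗ N ≅ M^{ab} ⊗_K N^{ab}, where M^{ab} = M/[M,M] and N^{ab} = N/[N,N]. -/
open scoped TensorProduct

namespace SuperNA

/-- The sign `(-1)^(|α||β|)` appearing in super-algebra identities. -/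
def ssign (α β : ZMod 2) : ℤ := (-1 : ℤ) ^ (α.val * β.val)

/-- A Lie superalgebra over a commutative unital ring `K`: a `ℤ/2`-graded `K`-module
with a bilinear bracket satisfying the graded skew-symmetry, the graded Jacobi
(Leibniz form) identity, and `[x₀,x₀] = 0` for even `x₀`. -/
structure LieSuperalgebra (K : Type) [CommRing K] : Type 1 where
  carrier : Type
  [isAddCommGroup : AddCommGroup carrier]
  [isModule : Module K carrier]
  grading : ZMod 2 → Submodule K carrier
  isInternal : DirectSum.IsInternal grading
  bracket : carrier →ₗ[K] carrier →ₗ[K] carrier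
  bracket_grading : ∀ (α β : ZMod 2) (x y : carrier),
    x ∈ grading α → y ∈ grading β → bracket x y ∈ grading (α + β)
  super_skew : ∀ (α β : ZMod 2) (x y : carrier), x ∈ grading α → y ∈ grading β →
    bracket x y = -(ssign α β • bracket y x)
  super_jacobi : ∀ (α β : ZMod 2) (x y : carrier), x ∈ grading α → y ∈ grading β →
    ∀ z : carrier, bracket x (bracket y z)
      = bracket (bracket x y) z + ssign α β • bracket y (bracket x z)
  bracket_self_even : ∀ x ∈ grading 0, bracket x x = 0

attribute [instance] LieSuperalgebra.isAddCommGroup LieSuperalgebra.isModule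

variable {K : Type} [CommRing K]

instance : CoeSort (LieSuperalgebra K) Type := ⟨LieSuperalgebra.carrier⟩

/-- A homomorphism of Lie superalgebras: an even linear map preserving brackets. -/
structure LieSuperHom (L M : LieSuperalgebra K) where
  toLinear : L.carrier →ₗ[K] M.carrier
  map_grading : ∀ (α : ZMod 2), ∀ x ∈ L.grading α, toLinear x ∈ M.grading α
  map_bracket : ∀ x y, toLinear (L.bracket x y) = M.bracket (toLinear x) (toLinear y)

/-- An action of the Lie superalgebra `P` on the Lie superalgebra `M`. -/
structure LieSuperAction (P M : LieSuperalgebra K) where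
  act : P.carrier →ₗ[K] M.carrier →ₗ[K] M.carrier
  act_grading : ∀ (α β : ZMod 2) (p : P.carrier) (m : M.carrier),
    p ∈ P.grading α → m ∈ M.grading β → act p m ∈ M.grading (α + β)
  act_bracket : ∀ (α β : ZMod 2) (p p' : P.carrier), p ∈ P.grading α → p' ∈ P.grading β →
    ∀ m : M.carrier, act (P.bracket p p') m = act p (act p' m) - ssign α β • act p' (act p m)
  act_super_der : ∀ (α β : ZMod 2) (p : P.carrier) (m : M.carrier),
    p ∈ P.grading α → m ∈ M.grading β → ∀ m' : M.carrier,
    act p (M.bracket m m') = M.bracket (act p m) m' + ssign α β • M.bracket m (act p m')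

/-- Two mutual actions are compatible. -/
structure AreCompatible {M N : LieSuperalgebra K}
    (aMN : LieSuperAction M N) (aNM : LieSuperAction N M) : Prop where
  compat_left : ∀ (α β : ZMod 2) (m : M.carrier) (n : N.carrier),
    m ∈ M.grading α → n ∈ N.grading β → ∀ n' : N.carrier,
    aMN.act (aNM.act n m) n' = -(ssign α β • N.bracket (aMN.act m n) n')
  compat_right : ∀ (α β : ZMod 2) (m : M.carrier) (n : N.carrier),
    m ∈ M.grading α → n ∈ N.grading β → ∀ m' : M.carrier,
    aNM.act (aMN.act m n) m' = -(ssign α β • M.bracket (aNM.act n m) m')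

/-- A crossed module of Lie superalgebras `∂ : M → P`. -/
structure CrossedModule (M P : LieSuperalgebra K) where
  act : LieSuperAction P M
  d : LieSuperHom M P
  cm_act : ∀ (p : P.carrier) (m : M.carrier), d.toLinear (act.act p m) = P.bracket p (d.toLinear m)
  cm_peiffer : ∀ (m m' : M.carrier), act.act (d.toLinear m) m' = M.bracket m m'

/-- A morphism of crossed `P`-modules. -/
structure CMHom {P M N : LieSuperalgebra K} (cmM : CrossedModule M P) (cmN : CrossedModule N P) where
  hom : LieSuperHom M N
  equivariant : ∀ (p : P.carrier) (m : M.carrier),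
    hom.toLinear (cmM.act.act p m) = cmN.act.act p (hom.toLinear m)
  comm : ∀ m : M.carrier, cmN.d.toLinear (hom.toLinear m) = cmM.d.toLinear m

/-- The data of a family of "tensor symbols" in a Lie superalgebra `Q`, indexed by pairs of
homogeneous elements of `M` and `N`, satisfying the defining relations of the non-abelian
tensor product `M ⊗ N`. -/
structure TensorData {M N : LieSuperalgebra K}
    (aMN : LieSuperAction M N) (aNM : LieSuperAction N M) (Q : LieSuperalgebra K) where
  pair : (α β : ZMod 2) → M.grading α → N.grading β → Q.carrier
  pair_grading : ∀ (α β : ZMod 2) (m : M.grading α) (n : N.grading β),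
    pair α β m n ∈ Q.grading (α + β)
  pair_smul_left : ∀ (α β : ZMod 2) (c : K) (m : M.grading α) (n : N.grading β),
    pair α β (c • m) n = c • pair α β m n
  pair_smul_right : ∀ (α β : ZMod 2) (c : K) (m : M.grading α) (n : N.grading β),
    pair α β m (c • n) = c • pair α β m n
  pair_add_left : ∀ (α β : ZMod 2) (m m' : M.grading α) (n : N.grading β),
    pair α β (m + m') n = pair α β m n + pair α β m' n
  pair_add_right : ∀ (α β : ZMod 2) (m : M.grading α) (n n' : N.grading β),
    pair α β m (n + n') = pair α β m n + pair α β m n'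
  pair_bracket_left : ∀ (α α' β : ZMod 2) (m : M.grading α) (m' : M.grading α') (n : N.grading β),
    pair (α + α') β ⟨M.bracket m.1 m'.1, M.bracket_grading α α' m.1 m'.1 m.2 m'.2⟩ n
      = pair α (α' + β) m ⟨aMN.act m'.1 n.1, aMN.act_grading α' β m'.1 n.1 m'.2 n.2⟩
        - ssign α α' • pair α' (α + β) m' ⟨aMN.act m.1 n.1, aMN.act_grading α β m.1 n.1 m.2 n.2⟩
  pair_bracket_right : ∀ (α β β' : ZMod 2) (m : M.grading α) (n : N.grading β) (n' : N.grading β'),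
    pair α (β + β') m ⟨N.bracket n.1 n'.1, N.bracket_grading β β' n.1 n'.1 n.2 n'.2⟩
      = ssign β' (α + β) • pair (β' + α) β
          ⟨aNM.act n'.1 m.1, aNM.act_grading β' α n'.1 m.1 n'.2 m.2⟩ n
        - ssign α β • pair (β + α) β'
          ⟨aNM.act n.1 m.1, aNM.act_grading β α n.1 m.1 n.2 m.2⟩ n'
  pair_bracket_pair : ∀ (α β α' β' : ZMod 2) (m : M.grading α) (n : N.grading β)
      (m' : M.grading α') (n' : N.grading β'),
    Q.bracket (pair α β m n) (pair α' β' m' n')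
      = -(ssign α β • pair (β + α) (α' + β')
          ⟨aNM.act n.1 m.1, aNM.act_grading β α n.1 m.1 n.2 m.2⟩
          ⟨aMN.act m'.1 n'.1, aMN.act_grading α' β' m'.1 n'.1 m'.2 n'.2⟩)

/-- `(T, ι)` is *the* non-abelian tensor product `M ⊗ N`: it is initial among Lie
superalgebras equipped with tensor symbols satisfying the defining relations.  This
universal property characterizes the Lie superalgebra presented by the generators
`m ⊗ n` and the relations of the non-abelian tensor product, uniquely up to isomorphism. -/
def IsNATensor {M N : LieSuperalgebra K} (aMN : LieSuperAction M N) (aNM : LieSuperAction N M)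
    (T : LieSuperalgebra K) (ι : TensorData aMN aNM T) : Prop :=
  ∀ (Q : LieSuperalgebra K) (d : TensorData aMN aNM Q),
    ∃! f : LieSuperHom T Q,
      ∀ (α β : ZMod 2) (m : M.grading α) (n : N.grading β),
        f.toLinear (ι.pair α β m n) = d.pair α β m n

/-- Tensor-symbol data additionally satisfying the relations of the non-abelian
exterior square `L ∧ L` (relative to an action `a` of `L` on itself). -/
structure ExtSqData {L : LieSuperalgebra K} (a : LieSuperAction L L) (Q : LieSuperalgebra K)
    extends TensorData a a Q where
  pair_alt : ∀ (α β : ZMod 2) (x : L.grading α) (y : L.grading β),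
    toTensorData.pair α β x y + ssign α β • toTensorData.pair β α y x = 0
  pair_self : ∀ x : L.grading 0, toTensorData.pair 0 0 x x = 0

/-- `(E, ι)` is the non-abelian exterior square `L ∧ L`. -/
def IsNAExtSq {L : LieSuperalgebra K} (a : LieSuperAction L L) (E : LieSuperalgebra K)
    (ι : ExtSqData a E) : Prop :=
  ∀ (Q : LieSuperalgebra K) (d : ExtSqData a Q),
    ∃! f : LieSuperHom E Q,
      ∀ (α β : ZMod 2) (x : L.grading α) (y : L.grading β),
        f.toLinear (ι.pair α β x y) = d.pair α β x y

/-- Generating family for a free Lie superalgebra on a graded set. -/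
structure FreeData (X : Type) (degX : X → ZMod 2) (F : LieSuperalgebra K) where
  gen : X → F.carrier
  gen_grading : ∀ x, gen x ∈ F.grading (degX x)

/-- `F` (with generators `i`) is the free Lie superalgebra on the graded set `(X, degX)`. -/
def IsFreeLieSuper {X : Type} (degX : X → ZMod 2) (F : LieSuperalgebra K)
    (i : FreeData X degX F) : Prop :=
  ∀ (M : LieSuperalgebra K) (j : FreeData X degX M),
    ∃! h : LieSuperHom F M, ∀ x, h.toLinear (i.gen x) = j.gen x

/-- The submodule spanned by brackets `[S, T]`. -/
def bracketSpan (L : LieSuperalgebra K) (S T : Submodule K L.carrier) :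
    Submodule K L.carrier :=
  Submodule.span K {z | ∃ x ∈ S, ∃ y ∈ T, z = L.bracket x y}

/-- Lower central series of a (sub-)Lie superalgebra `S ⊆ L`: `lcs 0 = S`,
`lcs (n+1) = [S, lcs n]`.  `S` is nilpotent of class `≤ c` iff `lcs c = ⊥`. -/
def lcs (L : LieSuperalgebra K) (S : Submodule K L.carrier) : ℕ → Submodule K L.carrier
  | 0 => S
  | n + 1 => bracketSpan L S (lcs L S n)

/-- Derived series of `S ⊆ L`.  `S` is solvable of derived length `≤ c` iff `ds c = ⊥`. -/
def ds (L : LieSuperalgebra K) (S : Submodule K L.carrier) : ℕ → Submodule K L.carrier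
  | 0 => S
  | n + 1 => bracketSpan L (ds L S n) (ds L S n)

/-- `S ⊆ L` is `n`-Engel: `ad(x)ⁿ = 0` on `S` for every `x ∈ S`. -/
def IsEngel (L : LieSuperalgebra K) (S : Submodule K L.carrier) (n : ℕ) : Prop :=
  ∀ x ∈ S, ∀ y ∈ S, ((L.bracket x) ^ n) y = 0

section Grading

variable {V W : Type} [AddCommGroup V] [Module K V] [AddCommGroup W] [Module K W]

/-- The induced grading on a submodule. -/
def gradeSub (g : ZMod 2 → Submodule K V) (S : Submodule K V) : ZMod 2 → Submodule K S :=
  fun α => (g α).comap S.subtype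

/-- The induced grading on a quotient module. -/
def gradeQuot (g : ZMod 2 → Submodule K V) (S : Submodule K V) : ZMod 2 → Submodule K (V ⧸ S) :=
  fun α => (g α).map S.mkQ

/-- The induced grading on a tensor product of supermodules. -/
def gradeTensor (gV : ZMod 2 → Submodule K V) (gW : ZMod 2 → Submodule K W) :
    ZMod 2 → Submodule K (V ⊗[K] W) :=
  fun γ => Submodule.span K {t | ∃ (α β : ZMod 2) (v : V) (w : W),
    α + β = γ ∧ v ∈ gV α ∧ w ∈ gW β ∧ t = v ⊗ₜ[K] w}

/-- A linear equivalence is an isomorphism of supermodules for the given gradings. -/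
def SuperEquiv (gV : ZMod 2 → Submodule K V) (gW : ZMod 2 → Submodule K W)
    (e : V ≃ₗ[K] W) : Prop :=
  ∀ α, (gV α).map e.toLinearMap = gW α

end Grading

/-- An associative (unital) superalgebra over `K`. -/
structure AssocSuperalgebra (K : Type) [CommRing K] : Type 1 where
  carrier : Type
  [isRing : Ring carrier]
  [isAlgebra : Algebra K carrier]
  grading : ZMod 2 → Submodule K carrier
  isInternal : DirectSum.IsInternal grading
  grading_mul : ∀ (α β : ZMod 2) (x y : carrier),
    x ∈ grading α → y ∈ grading β → x * y ∈ grading (α + β)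
  one_mem : (1 : carrier) ∈ grading 0

attribute [instance] AssocSuperalgebra.isRing AssocSuperalgebra.isAlgebra

/-- A (not necessarily unital) associative superalgebra over `K`. -/
structure NuAssocSuperalgebra (K : Type) [CommRing K] : Type 1 where
  carrier : Type
  [isRing : NonUnitalRing carrier]
  [isModule : Module K carrier]
  [isTower : IsScalarTower K carrier carrier]
  [isComm : SMulCommClass K carrier carrier]
  grading : ZMod 2 → Submodule K carrier
  isInternal : DirectSum.IsInternal grading
  grading_mul : ∀ (α β : ZMod 2) (x y : carrier),
    x ∈ grading α → y ∈ grading β → x * y ∈ grading (α + β)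

attribute [instance] NuAssocSuperalgebra.isRing NuAssocSuperalgebra.isModule
  NuAssocSuperalgebra.isTower NuAssocSuperalgebra.isComm

/-- The super-alternating relations inside `L ⊗ L`, whose quotient is `Λ²(L)`. -/
def altRel (L : LieSuperalgebra K) : Submodule K (L.carrier ⊗[K] L.carrier) :=
  Submodule.span K {t | ∃ (α β : ZMod 2) (x : L.grading α) (y : L.grading β),
    t = x.1 ⊗ₜ[K] y.1 + ssign α β • (y.1 ⊗ₜ[K] x.1)}

/-- The super-alternating relations inside `L ⊗ (L ⊗ L)`, whose quotient is `Λ³(L)`. -/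
def altRel3 (L : LieSuperalgebra K) :
    Submodule K (L.carrier ⊗[K] (L.carrier ⊗[K] L.carrier)) :=
  Submodule.span K
    ({t | ∃ (x : L.carrier) (r : L.carrier ⊗[K] L.carrier), r ∈ altRel L ∧ t = x ⊗ₜ[K] r} ∪
     {t | ∃ (α β : ZMod 2) (x : L.grading α) (y : L.grading β) (z : L.carrier),
        t = x.1 ⊗ₜ[K] (y.1 ⊗ₜ[K] z) + ssign α β • (y.1 ⊗ₜ[K] (x.1 ⊗ₜ[K] z))})


section GradedModules

variable {V W U : Type} [AddCommGroup V] [Module K V] [AddCommGroup W] [Module K W]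
  [AddCommGroup U] [Module K U]

/-- `p` is the projection onto the even part of `g` along its odd part. -/
structure IsEvenProj (g : ZMod 2 → Submodule K V) (p : V →ₗ[K] V) : Prop where
  map_even : ∀ v ∈ g 0, p v = v
  map_odd : ∀ v ∈ g 1, p v = 0
  mem_even : ∀ v, p v ∈ g 0
  sub_mem_odd : ∀ v, v - p v ∈ g 1

theorem isInternal_iff_isCompl (g : ZMod 2 → Submodule K V) :
    DirectSum.IsInternal g ↔ IsCompl (g 0) (g 1) :=
  DirectSum.isInternal_submodule_iff_isCompl g (by decide)
    (by ext a; revert a; simp only [Set.mem_univ, true_iff, Set.mem_insert_iff,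
      Set.mem_singleton_iff]; decide)

theorem IsEvenProj.isInternal {g : ZMod 2 → Submodule K V} {p : V →ₗ[K] V}
    (hp : IsEvenProj g p) : DirectSum.IsInternal g := by
  rw [isInternal_iff_isCompl]
  refine ⟨Submodule.disjoint_def.2 fun v h0 h1 => ?_,
    codisjoint_iff.2 (eq_top_iff.2 fun v _ => ?_)⟩
  · rw [← hp.map_even v h0, hp.map_odd v h1]
  · exact Submodule.mem_sup.2 ⟨p v, hp.mem_even v, v - p v, hp.sub_mem_odd v, by abel⟩

theorem exists_isEvenProj {g : ZMod 2 → Submodule K V} (hg : DirectSum.IsInternal g) :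
    ∃ p : V →ₗ[K] V, IsEvenProj g p := by
  have h := (isInternal_iff_isCompl g).1 hg
  have hodd : ∀ v ∈ g 1, ((g 0).subtype ∘ₗ (g 0).projectionOnto (g 1) h) v = 0 := fun v hv => by
    simpa using hv
  have heven : ∀ v ∈ g 0, ((g 0).subtype ∘ₗ (g 0).projectionOnto (g 1) h) v = v := fun v hv => by
    simpa using congrArg Subtype.val (Submodule.projectionOnto_apply_left h ⟨v, hv⟩)
  refine ⟨(g 0).subtype ∘ₗ (g 0).projectionOnto (g 1) h, heven, hodd, fun v => by simp, fun v => ?_⟩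
  obtain ⟨a, ha, b, hb, rfl⟩ := Submodule.mem_sup.1 (h.sup_eq_top ▸ Submodule.mem_top (x := v))
  rw [map_add, heven a ha, hodd b hb]
  simpa using hb

theorem exists_add_of_isInternal {g : ZMod 2 → Submodule K V} (hg : DirectSum.IsInternal g)
    (v : V) : ∃ a ∈ g 0, ∃ b ∈ g 1, a + b = v :=
  Submodule.mem_sup.1
    (((isInternal_iff_isCompl g).1 hg).sup_eq_top ▸ Submodule.mem_top (x := v))

/-- A bilinear map sending homogeneous pairs into a submodule sends all pairs into it. -/
theorem bilin_mem_of_homogeneous {gV : ZMod 2 → Submodule K V} {gW : ZMod 2 → Submodule K W}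
    (hV : DirectSum.IsInternal gV) (hW : DirectSum.IsInternal gW)
    (B : V →ₗ[K] W →ₗ[K] U) (S : Submodule K U)
    (h : ∀ (α β : ZMod 2) (v : gV α) (w : gW β), B v.1 w.1 ∈ S) (v : V) (w : W) :
    B v w ∈ S := by
  obtain ⟨a, ha, b, hb, rfl⟩ := exists_add_of_isInternal hV v
  obtain ⟨c, hc, d, hd, rfl⟩ := exists_add_of_isInternal hW w
  simp only [map_add, LinearMap.add_apply]
  exact add_mem (add_mem (h _ _ ⟨a, ha⟩ ⟨c, hc⟩) (h _ _ ⟨b, hb⟩ ⟨c, hc⟩))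
    (add_mem (h _ _ ⟨a, ha⟩ ⟨d, hd⟩) (h _ _ ⟨b, hb⟩ ⟨d, hd⟩))

theorem bilin_ext_of_homogeneous {gV : ZMod 2 → Submodule K V} {gW : ZMod 2 → Submodule K W}
    (hV : DirectSum.IsInternal gV) (hW : DirectSum.IsInternal gW) {B B' : V →ₗ[K] W →ₗ[K] U}
    (h : ∀ (α β : ZMod 2) (v : gV α) (w : gW β), B v.1 w.1 = B' v.1 w.1) : B = B' :=
  LinearMap.ext₂ fun v w => sub_eq_zero.1 <| (Submodule.mem_bot K).1 <|
    bilin_mem_of_homogeneous hV hW (B - B') ⊥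
      (fun α β v w => (Submodule.mem_bot K).2 (sub_eq_zero.2 (h α β v w))) v w

theorem linearMap_eq_zero_of_homogeneous {g : ZMod 2 → Submodule K V}
    (hg : DirectSum.IsInternal g) {φ : V →ₗ[K] U} (h : ∀ (α : ZMod 2) (v : g α), φ v.1 = 0) :
    φ = 0 := by
  ext v
  obtain ⟨a, ha, b, hb, rfl⟩ := exists_add_of_isInternal hg v
  rw [map_add, h 0 ⟨a, ha⟩, h 1 ⟨b, hb⟩, add_zero, LinearMap.zero_apply]

/-- Bilinear maps on homogeneous components glue to a bilinear map. -/
theorem exists_bilin_of_components {gV : ZMod 2 → Submodule K V} {gW : ZMod 2 → Submodule K W}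
    (hV : DirectSum.IsInternal gV) (hW : DirectSum.IsInternal gW)
    (b : ∀ α β, gV α →ₗ[K] gW β →ₗ[K] U) :
    ∃ B : V →ₗ[K] W →ₗ[K] U, ∀ (α β : ZMod 2) (v : gV α) (w : gW β), B v.1 w.1 = b α β v w := by
  let eV := LinearEquiv.ofBijective (DirectSum.coeLinearMap gV) hV
  let eW := LinearEquiv.ofBijective (DirectSum.coeLinearMap gW) hW
  have hv : ∀ (α) (v : gV α), eV.symm v.1 = DirectSum.lof K _ (fun α => gV α) α v :=
    fun α v => eV.symm_apply_eq.2 (DirectSum.coeLinearMap_lof gV α v).symm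
  have hw : ∀ (β) (w : gW β), eW.symm w.1 = DirectSum.lof K _ (fun β => gW β) β w :=
    fun β w => eW.symm_apply_eq.2 (DirectSum.coeLinearMap_lof gW β w).symm
  refine ⟨DirectSum.toModule K _ _ (fun α => (DirectSum.toModule K _ (gV α →ₗ[K] U)
    (fun β => (b α β).flip) ∘ₗ eW.symm.toLinearMap).flip) ∘ₗ eV.symm.toLinearMap,
    fun α β v w => ?_⟩
  simp [hv, hw, DirectSum.toModule_lof]

theorem tmul_mem_gradeTensor {gV : ZMod 2 → Submodule K V} {gW : ZMod 2 → Submodule K W}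
    {α β : ZMod 2} {v : V} {w : W} (hv : v ∈ gV α) (hw : w ∈ gW β) :
    v ⊗ₜ[K] w ∈ gradeTensor gV gW (α + β) :=
  Submodule.subset_span ⟨α, β, v, w, rfl, hv, hw, rfl⟩

theorem IsEvenProj.tensor {gV : ZMod 2 → Submodule K V} {gW : ZMod 2 → Submodule K W}
    {p : V →ₗ[K] V} {q : W →ₗ[K] W} (hp : IsEvenProj gV p) (hq : IsEvenProj gW q) :
    IsEvenProj (gradeTensor gV gW)
      (TensorProduct.map p q + TensorProduct.map (LinearMap.id - p) (LinearMap.id - q)) := by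
  have cases2 : ∀ α : ZMod 2, α = 0 ∨ α = 1 := by decide
  refine ⟨fun t ht => ?_, fun t ht => ?_, fun t => ?_, fun t => ?_⟩
  · induction ht using Submodule.span_induction with
    | mem t ht =>
      obtain ⟨α, β, v, w, h, hv, hw, rfl⟩ := ht
      rcases cases2 α with rfl | rfl <;> rcases cases2 β with rfl | rfl
      · simp [hp.map_even v hv, hq.map_even w hw]
      · exact absurd h (by decide)
      · exact absurd h (by decide)
      · simp [hp.map_odd v hv, hq.map_odd w hw]
    | zero => simp
    | add x y _ _ hx hy => rw [map_add, hx, hy]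
    | smul c x _ hx => rw [map_smul, hx]
  · induction ht using Submodule.span_induction with
    | mem t ht =>
      obtain ⟨α, β, v, w, h, hv, hw, rfl⟩ := ht
      rcases cases2 α with rfl | rfl <;> rcases cases2 β with rfl | rfl
      · exact absurd h (by decide)
      · simp [hp.map_even v hv, hq.map_odd w hw]
      · simp [hp.map_odd v hv, hq.map_even w hw]
      · exact absurd h (by decide)
    | zero => simp
    | add x y _ _ hx hy => rw [map_add, hx, hy, add_zero]
    | smul c x _ hx => rw [map_smul, hx, smul_zero]
  · induction t using TensorProduct.induction_on with
    | zero => simp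
    | add x y hx hy => rw [map_add]; exact add_mem hx hy
    | tmul v w =>
      rw [LinearMap.add_apply, TensorProduct.map_tmul, TensorProduct.map_tmul]
      exact add_mem
        (Submodule.subset_span ⟨0, 0, _, _, by decide, hp.mem_even v, hq.mem_even w, rfl⟩)
        (Submodule.subset_span ⟨1, 1, _, _, by decide, hp.sub_mem_odd v, hq.sub_mem_odd w, rfl⟩)
  · induction t using TensorProduct.induction_on with
    | zero => simp
    | add x y hx hy => rw [map_add, add_sub_add_comm]; exact add_mem hx hy
    | tmul v w =>
      have key : v ⊗ₜ[K] w - (TensorProduct.map p q (v ⊗ₜ[K] w)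
          + TensorProduct.map (LinearMap.id - p) (LinearMap.id - q) (v ⊗ₜ[K] w))
          = p v ⊗ₜ[K] (w - q w) + (v - p v) ⊗ₜ[K] q w := by
        simp only [TensorProduct.map_tmul, LinearMap.sub_apply,
          LinearMap.id_apply, TensorProduct.sub_tmul, TensorProduct.tmul_sub]
        abel
      rw [LinearMap.add_apply, key]
      exact add_mem
        (Submodule.subset_span ⟨0, 1, _, _, by decide, hp.mem_even v, hq.sub_mem_odd w, rfl⟩)
        (Submodule.subset_span ⟨1, 0, _, _, by decide, hp.sub_mem_odd v, hq.mem_even w, rfl⟩)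

theorem IsEvenProj.quot {g : ZMod 2 → Submodule K V} {p : V →ₗ[K] V} (hp : IsEvenProj g p)
    (S : Submodule K V) (hS : S ≤ S.comap p) : IsEvenProj (gradeQuot g S) (S.mapQ S p hS) := by
  refine ⟨?_, ?_, fun v => ?_, fun v => ?_⟩
  · rintro _ ⟨v, hv, rfl⟩
    simp [hp.map_even v hv]
  · rintro _ ⟨v, hv, rfl⟩
    simp [hp.map_odd v hv]
  · obtain ⟨v, rfl⟩ := S.mkQ_surjective v
    exact ⟨p v, hp.mem_even v, by simp⟩
  · obtain ⟨v, rfl⟩ := S.mkQ_surjective v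
    exact ⟨v - p v, hp.sub_mem_odd v, by simp⟩

theorem IsEvenProj.sub {g : ZMod 2 → Submodule K V} {p : V →ₗ[K] V} (hp : IsEvenProj g p)
    (S : Submodule K V) (hS : ∀ v ∈ S, p v ∈ S) : IsEvenProj (gradeSub g S) (p.restrict hS) where
  map_even v hv := Subtype.ext (hp.map_even v.1 hv)
  map_odd v hv := Subtype.ext (hp.map_odd v.1 hv)
  mem_even v := hp.mem_even v.1
  sub_mem_odd v := hp.sub_mem_odd v.1

theorem IsEvenProj.homogeneous_mem {g : ZMod 2 → Submodule K V} {p : V →ₗ[K] V}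
    (hp : IsEvenProj g p) {S : Submodule K V} {α : ZMod 2} {v : V} (hv : v ∈ g α) (hS : v ∈ S) :
    p v ∈ S := by
  have cases2 : ∀ α : ZMod 2, α = 0 ∨ α = 1 := by decide
  rcases cases2 α with rfl | rfl
  · rwa [hp.map_even v hv]
  · rw [hp.map_odd v hv]
    exact S.zero_mem

end GradedModules

theorem bracket_mem_bracketSpan (L : LieSuperalgebra K) (x y : L.carrier) :
    L.bracket x y ∈ bracketSpan L ⊤ ⊤ :=
  Submodule.subset_span ⟨x, trivial, y, trivial, rfl⟩

theorem bracketSpan_le_ker {U : Type} [AddCommGroup U] [Module K U] (L : LieSuperalgebra K)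
    (φ : L.carrier →ₗ[K] U)
    (h : ∀ (α β : ZMod 2) (x : L.grading α) (y : L.grading β), φ (L.bracket x.1 y.1) = 0) :
    bracketSpan L ⊤ ⊤ ≤ LinearMap.ker φ := by
  refine Submodule.span_le.2 ?_
  rintro _ ⟨x, -, y, -, rfl⟩
  exact bilin_mem_of_homogeneous L.isInternal L.isInternal L.bracket (LinearMap.ker φ) h x y

/-- The grading induced on the abelianization comes from an even projection. -/
theorem exists_isEvenProj_abelianization (L : LieSuperalgebra K) :
    ∃ p, IsEvenProj (gradeQuot L.grading (bracketSpan L ⊤ ⊤)) p := by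
  obtain ⟨p, hp⟩ := exists_isEvenProj L.isInternal
  refine ⟨_, hp.quot (bracketSpan L ⊤ ⊤) (Submodule.span_le.2 ?_)⟩
  rintro _ ⟨x, -, y, -, rfl⟩
  exact bilin_mem_of_homogeneous L.isInternal L.isInternal L.bracket
    ((bracketSpan L ⊤ ⊤).comap p) (fun α β x y =>
      hp.homogeneous_mem (L.bracket_grading α β _ _ x.2 y.2)
        (bracket_mem_bracketSpan L x.1 y.1)) x y

/-- A graded submodule closed under the bracket, as a Lie superalgebra. -/
def LieSuperalgebra.sub (L : LieSuperalgebra K) (S : Submodule K L.carrier)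
    (hint : DirectSum.IsInternal (gradeSub L.grading S))
    (hS : ∀ x ∈ S, ∀ y ∈ S, L.bracket x y ∈ S) : LieSuperalgebra K where
  carrier := S
  grading := gradeSub L.grading S
  isInternal := hint
  bracket := LinearMap.mk₂ K (fun x y => ⟨L.bracket x.1 y.1, hS _ x.2 _ y.2⟩)
    (fun _ _ _ => Subtype.ext (by simp)) (fun _ _ _ => Subtype.ext (by simp))
    (fun _ _ _ => Subtype.ext (by simp)) (fun _ _ _ => Subtype.ext (by simp))
  bracket_grading α β x y hx hy := L.bracket_grading α β x.1 y.1 hx hy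
  super_skew α β x y hx hy := Subtype.ext (L.super_skew α β x.1 y.1 hx hy)
  super_jacobi α β x y hx hy z := Subtype.ext (L.super_jacobi α β x.1 y.1 hx hy z.1)
  bracket_self_even x hx := Subtype.ext (L.bracket_self_even x.1 hx)

/-- A supermodule, as an abelian Lie superalgebra. -/
def abelianLieSuperalgebra {V : Type} [AddCommGroup V] [Module K V]
    (g : ZMod 2 → Submodule K V) (hg : DirectSum.IsInternal g) : LieSuperalgebra K where
  carrier := V
  grading := g
  isInternal := hg
  bracket := 0
  bracket_grading _ _ _ _ _ _ := by simp
  super_skew := by simp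
  super_jacobi := by simp
  bracket_self_even := by simp

namespace TensorData

variable {M N T : LieSuperalgebra K} {aMN : LieSuperAction M N} {aNM : LieSuperAction N M}

/-- The tensor symbols of fixed degrees as a bilinear map. -/
def pairBilin (ι : TensorData aMN aNM T) (α β : ZMod 2) :
    M.grading α →ₗ[K] N.grading β →ₗ[K] T.carrier :=
  LinearMap.mk₂ K (ι.pair α β) (ι.pair_add_left α β) (ι.pair_smul_left α β)
    (ι.pair_add_right α β) (ι.pair_smul_right α β)

theorem pair_eq_zero_left (ι : TensorData aMN aNM T) {α β : ZMod 2} {m : M.grading α}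
    {n : N.grading β} (hm : m.1 = 0) : ι.pair α β m n = 0 := by
  obtain rfl : m = 0 := Subtype.ext hm
  exact (ι.pairBilin α β).map_zero₂ n

theorem pair_eq_zero_right (ι : TensorData aMN aNM T) {α β : ZMod 2} {m : M.grading α}
    {n : N.grading β} (hn : n.1 = 0) : ι.pair α β m n = 0 := by
  obtain rfl : n = 0 := Subtype.ext hn
  exact map_zero (ι.pairBilin α β m)

/-- The submodule spanned by the tensor symbols. -/
def symbolSpan (ι : TensorData aMN aNM T) : Submodule K T.carrier :=
  Submodule.span K {t | ∃ α β m n, t = ι.pair α β m n}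

theorem pair_mem_symbolSpan (ι : TensorData aMN aNM T) (α β : ZMod 2) (m : M.grading α)
    (n : N.grading β) : ι.pair α β m n ∈ ι.symbolSpan :=
  Submodule.subset_span ⟨α, β, m, n, rfl⟩

theorem bracket_mem_symbolSpan (ι : TensorData aMN aNM T) :
    ∀ x ∈ ι.symbolSpan, ∀ y ∈ ι.symbolSpan, T.bracket x y ∈ ι.symbolSpan := by
  intro x hx y hy
  induction hx, hy using Submodule.span_induction₂ with
  | mem_mem x y hx hy =>
    obtain ⟨α, β, m, n, rfl⟩ := hx
    obtain ⟨α', β', m', n', rfl⟩ := hy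
    rw [ι.pair_bracket_pair]
    exact neg_mem (zsmul_mem (ι.pair_mem_symbolSpan _ _ _ _) _)
  | zero_left => simp
  | zero_right => simp
  | add_left x y z _ _ _ hx hy => simpa using add_mem hx hy
  | add_right x y z _ _ _ hx hy => simpa using add_mem hx hy
  | smul_left c x y _ _ h => simpa using Submodule.smul_mem _ c h
  | smul_right c x y _ _ h => simpa using Submodule.smul_mem _ c h

theorem isInternal_gradeSub_symbolSpan (ι : TensorData aMN aNM T) :
    DirectSum.IsInternal (gradeSub T.grading ι.symbolSpan) := by
  obtain ⟨p, hp⟩ := exists_isEvenProj T.isInternal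
  have hle : ι.symbolSpan ≤ ι.symbolSpan.comap p := by
    refine Submodule.span_le.2 ?_
    rintro _ ⟨α, β, m, n, rfl⟩
    exact hp.homogeneous_mem (ι.pair_grading α β m n) (ι.pair_mem_symbolSpan α β m n)
  exact (hp.sub _ hle).isInternal

/-- The tensor symbols, viewed in the Lie superalgebra they span. -/
def corestrict (ι : TensorData aMN aNM T) :
    TensorData aMN aNM
      (T.sub ι.symbolSpan ι.isInternal_gradeSub_symbolSpan ι.bracket_mem_symbolSpan) where
  pair α β m n := ⟨ι.pair α β m n, ι.pair_mem_symbolSpan α β m n⟩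
  pair_grading := ι.pair_grading
  pair_smul_left α β c m n := Subtype.ext (ι.pair_smul_left α β c m n)
  pair_smul_right α β c m n := Subtype.ext (ι.pair_smul_right α β c m n)
  pair_add_left α β m m' n := Subtype.ext (ι.pair_add_left α β m m' n)
  pair_add_right α β m n n' := Subtype.ext (ι.pair_add_right α β m n n')
  pair_bracket_left α α' β m m' n := Subtype.ext (ι.pair_bracket_left α α' β m m' n)
  pair_bracket_right α β β' m n n' := Subtype.ext (ι.pair_bracket_right α β β' m n n')
  pair_bracket_pair α β α' β' m n m' n' :=
    Subtype.ext (ι.pair_bracket_pair α β α' β' m n m' n')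

/-- The symbols `[m] ⊗ [n]` in the tensor product of the abelianizations, for trivial actions. -/
def abelianization (hMN : aMN.act = 0) (hNM : aNM.act = 0)
    (hg : DirectSum.IsInternal (gradeTensor (gradeQuot M.grading (bracketSpan M ⊤ ⊤))
      (gradeQuot N.grading (bracketSpan N ⊤ ⊤)))) :
    TensorData aMN aNM (abelianLieSuperalgebra _ hg) where
  pair _ _ m n := (bracketSpan M ⊤ ⊤).mkQ m.1 ⊗ₜ[K] (bracketSpan N ⊤ ⊤).mkQ n.1
  pair_grading _ _ m n :=
    tmul_mem_gradeTensor (Submodule.mem_map_of_mem m.2) (Submodule.mem_map_of_mem n.2)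
  pair_smul_left _ _ c m n := by
    rw [Submodule.coe_smul, map_smul]
    exact TensorProduct.smul_tmul' c ((bracketSpan M ⊤ ⊤).mkQ m.1) ((bracketSpan N ⊤ ⊤).mkQ n.1)
  pair_smul_right _ _ c m n := by
    rw [Submodule.coe_smul, map_smul]
    exact TensorProduct.tmul_smul c
      ((bracketSpan M ⊤ ⊤).mkQ m.1) ((bracketSpan N ⊤ ⊤).mkQ n.1)
  pair_add_left _ _ m m' n := by
    rw [Submodule.coe_add, map_add]; exact TensorProduct.add_tmul _ _ _
  pair_add_right _ _ m n n' := by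
    rw [Submodule.coe_add, map_add]; exact TensorProduct.tmul_add _ _ _
  pair_bracket_left α α' β m m' n := by
    have h : (bracketSpan M ⊤ ⊤).mkQ (M.bracket m.1 m'.1) = 0 :=
      (Submodule.Quotient.mk_eq_zero _).2 (bracket_mem_bracketSpan _ _ _)
    simp only [h, hMN, LinearMap.zero_apply, map_zero, TensorProduct.zero_tmul,
      TensorProduct.tmul_zero]
    exact (by simp : (0 : (abelianLieSuperalgebra _ hg).carrier) = 0 - ssign α α' • 0)
  pair_bracket_right α β β' m n n' := by
    have h : (bracketSpan N ⊤ ⊤).mkQ (N.bracket n.1 n'.1) = 0 :=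
      (Submodule.Quotient.mk_eq_zero _).2 (bracket_mem_bracketSpan _ _ _)
    simp only [h, hNM, LinearMap.zero_apply, map_zero, TensorProduct.zero_tmul,
      TensorProduct.tmul_zero]
    exact (by simp : (0 : (abelianLieSuperalgebra _ hg).carrier)
      = ssign β' (α + β) • 0 - ssign α β • 0)
  pair_bracket_pair α β α' β' m n m' n' := by
    simp only [hMN, hNM, LinearMap.zero_apply, map_zero, TensorProduct.tmul_zero]
    exact (by simp : (0 : (abelianLieSuperalgebra _ hg).carrier) = -(ssign α β • 0))

theorem bracket_eq_zero (ι : TensorData aMN aNM T) (hMN : aMN.act = 0)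
    (hι : ι.symbolSpan = ⊤) (x y : T.carrier) : T.bracket x y = 0 := by
  have hx : x ∈ ι.symbolSpan := hι ▸ Submodule.mem_top
  have hy : y ∈ ι.symbolSpan := hι ▸ Submodule.mem_top
  induction hx, hy using Submodule.span_induction₂ with
  | mem_mem x y hx hy =>
    obtain ⟨α, β, m, n, rfl⟩ := hx
    obtain ⟨α', β', m', n', rfl⟩ := hy
    rw [ι.pair_bracket_pair, ι.pair_eq_zero_right (by simp [hMN]), smul_zero, neg_zero]
  | zero_left => simp
  | zero_right => simp
  | add_left x y z _ _ _ hx hy => simp [hx, hy]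
  | add_right x y z _ _ _ hx hy => simp [hx, hy]
  | smul_left c x y _ _ h => simp [h]
  | smul_right c x y _ _ h => simp [h]

end TensorData

/-- The tensor symbols span the non-abelian tensor product. -/
theorem IsNATensor.symbolSpan_eq_top {M N T : LieSuperalgebra K} {aMN : LieSuperAction M N}
    {aNM : LieSuperAction N M} {ι : TensorData aMN aNM T} (hT : IsNATensor aMN aNM T ι) :
    ι.symbolSpan = ⊤ := by
  obtain ⟨f, hf, -⟩ := hT _ ι.corestrict
  let incl : LieSuperHom T T :=
    { toLinear := ι.symbolSpan.subtype ∘ₗ f.toLinear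
      map_grading := f.map_grading
      map_bracket := fun x y => congrArg Subtype.val (f.map_bracket x y) }
  let ident : LieSuperHom T T := ⟨LinearMap.id, fun _ _ h => h, fun _ _ => rfl⟩
  have h : incl = ident := (hT T ι).unique
    (fun α β m n => congrArg Subtype.val (hf α β m n)) (fun _ _ _ _ => rfl)
  refine eq_top_iff.2 fun x _ => ?_
  have hx : incl.toLinear x = x := by rw [h]; rfl
  rw [← hx]
  exact (f.toLinear x).2

/-- The canonical map `M ⊗_K N → M ⊗ N` is an even surjective
homomorphism of supermodules; if the actions are trivial, `M ⊗ N` is abelian and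
`M ⊗ N ≅ M^{ab} ⊗_K N^{ab}` as supermodules. -/
theorem statement3 {K : Type} [CommRing K] (M N : LieSuperalgebra K)
    (aMN : LieSuperAction M N) (aNM : LieSuperAction N M)
    (hcomp : AreCompatible aMN aNM)
    (T : LieSuperalgebra K) (ι : TensorData aMN aNM T) (hT : IsNATensor aMN aNM T ι) :
    -- the canonical map `M ⊗_K N → M ⊗ N` is an even surjective homomorphism of supermodules
    (∃ c : M.carrier ⊗[K] N.carrier →ₗ[K] T.carrier,
      (∀ (α β : ZMod 2) (m : M.grading α) (n : N.grading β),
        c (m.1 ⊗ₜ[K] n.1) = ι.pair α β m n) ∧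
      (∀ γ : ZMod 2, ∀ t ∈ gradeTensor M.grading N.grading γ, c t ∈ T.grading γ) ∧
      Function.Surjective c) ∧
    -- if moreover the actions are trivial:
    (aMN.act = 0 → aNM.act = 0 →
      -- `M ⊗ N` is an abelian Lie superalgebra
      (∀ x y : T.carrier, T.bracket x y = 0) ∧
      -- and `M ⊗ N ≅ M^{ab} ⊗_K N^{ab}` as supermodules
      (∃ e : T.carrier ≃ₗ[K]
          (M.carrier ⧸ bracketSpan M ⊤ ⊤) ⊗[K] (N.carrier ⧸ bracketSpan N ⊤ ⊤),
        SuperEquiv T.grading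
          (gradeTensor (gradeQuot M.grading (bracketSpan M ⊤ ⊤))
            (gradeQuot N.grading (bracketSpan N ⊤ ⊤))) e ∧
        ∀ (α β : ZMod 2) (m : M.grading α) (n : N.grading β),
          e (ι.pair α β m n)
            = ((bracketSpan M ⊤ ⊤).mkQ m.1) ⊗ₜ[K] ((bracketSpan N ⊤ ⊤).mkQ n.1))) := by
  obtain ⟨B, hB⟩ := exists_bilin_of_components M.isInternal N.isInternal ι.pairBilin
  have hBp : ∀ (α β : ZMod 2) (m : M.grading α) (n : N.grading β),
      B m.1 n.1 = ι.pair α β m n := hB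
  have hι := hT.symbolSpan_eq_top
  have hsurj : Function.Surjective (TensorProduct.lift B) := by
    rw [← LinearMap.range_eq_top, eq_top_iff, ← hι]
    refine Submodule.span_le.2 ?_
    rintro _ ⟨α, β, m, n, rfl⟩
    exact ⟨m.1 ⊗ₜ[K] n.1, hBp α β m n⟩
  refine ⟨⟨TensorProduct.lift B, hBp, fun γ t ht => ?_, hsurj⟩, fun hMN hNM => ?_⟩
  · induction ht using Submodule.span_induction with
    | mem t ht =>
      obtain ⟨α, β, m, n, rfl, hm, hn, rfl⟩ := ht
      rw [TensorProduct.lift.tmul, hBp α β ⟨m, hm⟩ ⟨n, hn⟩]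
      exact ι.pair_grading _ _ _ _
    | zero => simp
    | add x y _ _ hx hy => rw [map_add]; exact add_mem hx hy
    | smul c x _ hx => rw [map_smul]; exact Submodule.smul_mem _ c hx
  · refine ⟨ι.bracket_eq_zero hMN hι, ?_⟩
    obtain ⟨p, hp⟩ := exists_isEvenProj_abelianization M
    obtain ⟨q, hq⟩ := exists_isEvenProj_abelianization N
    obtain ⟨f, hf, -⟩ := hT _ (TensorData.abelianization hMN hNM (hp.tensor hq).isInternal)
    let F : T.carrier →ₗ[K]
      (M.carrier ⧸ bracketSpan M ⊤ ⊤) ⊗[K] (N.carrier ⧸ bracketSpan N ⊤ ⊤) := f.toLinear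
    have hF : ∀ (α β : ZMod 2) (m : M.grading α) (n : N.grading β), F (ι.pair α β m n)
        = (bracketSpan M ⊤ ⊤).mkQ m.1 ⊗ₜ[K] (bracketSpan N ⊤ ⊤).mkQ n.1 := hf
    let π := (bracketSpan M ⊤ ⊤).mkQ
    let ρ := (bracketSpan N ⊤ ⊤).mkQ
    have hFB : B.compr₂ F = (TensorProduct.mk K _ _).compl₁₂ π ρ :=
      bilin_ext_of_homogeneous M.isInternal N.isInternal fun α β m n =>
        (congrArg F (hBp α β m n)).trans (hF α β m n)
    have hleft : bracketSpan M ⊤ ⊤ ≤ LinearMap.ker B :=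
      bracketSpan_le_ker M B fun α α' m m' =>
        linearMap_eq_zero_of_homogeneous N.isInternal fun β n => by
          rw [hBp _ β ⟨_, M.bracket_grading α α' m.1 m'.1 m.2 m'.2⟩ n, ι.pair_bracket_left,
            ι.pair_eq_zero_right (by simp [hMN]), ι.pair_eq_zero_right (by simp [hMN]),
            smul_zero, sub_zero]
    have hright : bracketSpan N ⊤ ⊤ ≤ LinearMap.ker B.flip :=
      bracketSpan_le_ker N B.flip fun β β' n n' =>
        linearMap_eq_zero_of_homogeneous M.isInternal fun α m => by
          rw [LinearMap.flip_apply, hBp α _ m ⟨_, N.bracket_grading β β' n.1 n'.1 n.2 n'.2⟩,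
            ι.pair_bracket_right, ι.pair_eq_zero_left (by simp [hNM]),
            ι.pair_eq_zero_left (by simp [hNM]), smul_zero, smul_zero, sub_zero]
    let B' : (M.carrier ⧸ bracketSpan M ⊤ ⊤) →ₗ[K] (N.carrier ⧸ bracketSpan N ⊤ ⊤) →ₗ[K] T.carrier :=
      Submodule.liftQ _ (Submodule.liftQ _ B.flip hright).flip fun m hm => by
        refine LinearMap.ext fun n => ?_
        obtain ⟨n, rfl⟩ := Submodule.mkQ_surjective _ n
        exact LinearMap.congr_fun (LinearMap.mem_ker.1 (hleft hm)) n
    have hB' : ∀ m n, B' (π m) (ρ n) = B m n := fun _ _ => rfl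
    let e : T.carrier ≃ₗ[K]
        (M.carrier ⧸ bracketSpan M ⊤ ⊤) ⊗[K] (N.carrier ⧸ bracketSpan N ⊤ ⊤) :=
      LinearEquiv.ofLinearMap F (TensorProduct.lift B')
        (TensorProduct.ext' fun x y => by
          obtain ⟨m, rfl⟩ := Submodule.mkQ_surjective _ x
          obtain ⟨n, rfl⟩ := Submodule.mkQ_surjective _ y
          exact LinearMap.congr_fun₂ hFB m n)
        (LinearMap.ext fun t => by
          obtain ⟨t, rfl⟩ := hsurj t
          induction t using TensorProduct.induction_on with
          | zero => simp
          | tmul m n =>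
            exact congrArg (TensorProduct.lift B') (LinearMap.congr_fun₂ hFB m n)
          | add x y hx hy => rw [map_add, map_add, hx, hy, map_add])
    refine ⟨e, fun γ => le_antisymm ?_ (Submodule.span_le.2 ?_), hF⟩
    · rintro _ ⟨t, ht, rfl⟩
      exact f.map_grading γ t ht
    · rintro _ ⟨α, β, _, _, rfl, ⟨m, hm, rfl⟩, ⟨n, hn, rfl⟩, rfl⟩
      exact ⟨_, ι.pair_grading α β ⟨m, hm⟩ ⟨n, hn⟩, hF α β ⟨m, hm⟩ ⟨n, hn⟩⟩

end SuperNA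
end

section
/- Let M and N be Lie superalgebras over a commutative unital ring K acting compatibly on each other. Then the Lie superalgebra homomorphism M ⊗ N → N ⊗ M determined by m ⊗ n ↦ −(−1)^{|m||n|}(n ⊗ m) is an isomorphism. -/
open scoped TensorProduct

namespace SuperNA

variable {K : Type} [CommRing K]

theorem ssign_comm (α β : ZMod 2) : ssign α β = ssign β α := by
  simp only [ssign, mul_comm]

theorem ssign_add_left (α β γ : ZMod 2) : ssign (α + β) γ = ssign α γ * ssign β γ := by
  revert α β γ; decide

theorem ssign_add_right (α β γ : ZMod 2) : ssign α (β + γ) = ssign α β * ssign α γ := by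
  revert α β γ; decide

theorem ssign_mul_self (α β : ZMod 2) : ssign α β * ssign α β = 1 := by
  revert α β; decide

/-- The identity homomorphism. -/
def LieSuperHom.id (L : LieSuperalgebra K) : LieSuperHom L L where
  toLinear := LinearMap.id
  map_grading _ _ hx := hx
  map_bracket _ _ := rfl

/-- Composition of homomorphisms of Lie superalgebras. -/
def LieSuperHom.comp {L M N : LieSuperalgebra K} (g : LieSuperHom M N) (f : LieSuperHom L M) :
    LieSuperHom L N where
  toLinear := g.toLinear ∘ₗ f.toLinear
  map_grading α x hx := g.map_grading α _ (f.map_grading α x hx)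
  map_bracket x y := by simp [f.map_bracket, g.map_bracket]

/-- The symbols `m ⊗ n ↦ -(-1)^(|m||n|) (n ⊗ m)` satisfy the relations of `M ⊗ N` whenever the
symbols `n ⊗ m` satisfy those of `N ⊗ M`. -/
def TensorData.swap {M N : LieSuperalgebra K} {aMN : LieSuperAction M N}
    {aNM : LieSuperAction N M} {Q : LieSuperalgebra K} (d : TensorData aNM aMN Q) :
    TensorData aMN aNM Q where
  pair α β m n := -(ssign α β • d.pair β α n m)
  pair_grading α β m n := by
    rw [add_comm α β]
    exact neg_mem (zsmul_mem (d.pair_grading β α n m) _)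
  pair_smul_left α β c m n := by
    rw [d.pair_smul_right, smul_neg, smul_comm c]
  pair_smul_right α β c m n := by
    rw [d.pair_smul_left, smul_neg, smul_comm c]
  pair_add_left α β m m' n := by
    rw [d.pair_add_right, smul_add, neg_add]
  pair_add_right α β m n n' := by
    rw [d.pair_add_left, smul_add, neg_add]
  pair_bracket_left α α' β m m' n := by
    rw [d.pair_bracket_right]
    simp only [ssign_add_left, ssign_add_right, ssign_comm β, ssign_comm α' α]
    have h₁ := ssign_mul_self α' β
    have h₂ := ssign_mul_self α β
    have h₃ := ssign_mul_self α α'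
    match_scalars
    · linear_combination (-ssign α β * ssign α α') * h₁
    · linear_combination ssign α' β * h₂ - ssign α' β * h₃
  pair_bracket_right α β β' m n n' := by
    rw [d.pair_bracket_left]
    simp only [ssign_add_left, ssign_add_right, ssign_comm β' α, ssign_comm β' β]
    have h₁ := ssign_mul_self β β'
    match_scalars
    · linear_combination (ssign α β * ssign α β') * h₁
    · ring
  pair_bracket_pair α β α' β' m n m' n' := by
    have h := Q.super_skew _ _ _ _ (d.pair_grading β α n m) (d.pair_grading β' α' n' m')
    simp only [map_neg, map_zsmul, LinearMap.neg_apply, LinearMap.smul_apply, neg_neg, smul_neg]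
    rw [h, d.pair_bracket_pair]
    simp only [ssign_comm β' α', ssign_add_left, ssign_add_right]
    have h₁ := ssign_mul_self α' β'
    match_scalars
    linear_combination
      (ssign α β * ssign β β' * ssign α β' * ssign β α' * ssign α α') * h₁

/-- A homomorphism out of a tensor product fixing all symbols is the identity. -/
theorem IsNATensor.eq_id {M N : LieSuperalgebra K} {aMN : LieSuperAction M N}
    {aNM : LieSuperAction N M} {T : LieSuperalgebra K} {ι : TensorData aMN aNM T}
    (hT : IsNATensor aMN aNM T ι) (f : LieSuperHom T T)
    (hf : ∀ (α β : ZMod 2) (m : M.grading α) (n : N.grading β),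
      f.toLinear (ι.pair α β m n) = ι.pair α β m n) (x : T.carrier) : f.toLinear x = x := by
  rw [(hT T ι).unique hf (y₂ := LieSuperHom.id T) fun _ _ _ _ => rfl]
  rfl

/-- Swapping the tensor factors twice fixes every symbol. -/
theorem swap_swap_pair {M N : LieSuperalgebra K} {T T' : LieSuperalgebra K}
    {aMN : LieSuperAction M N} {aNM : LieSuperAction N M}
    {ι : TensorData aMN aNM T} {ι' : TensorData aNM aMN T'}
    {f : LieSuperHom T T'} {g : LieSuperHom T' T}
    (hf : ∀ (α β : ZMod 2) (m : M.grading α) (n : N.grading β),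
      f.toLinear (ι.pair α β m n) = -(ssign α β • ι'.pair β α n m))
    (hg : ∀ (β α : ZMod 2) (n : N.grading β) (m : M.grading α),
      g.toLinear (ι'.pair β α n m) = -(ssign β α • ι.pair α β m n))
    (α β : ZMod 2) (m : M.grading α) (n : N.grading β) :
    (g.comp f).toLinear (ι.pair α β m n) = ι.pair α β m n := by
  change g.toLinear (f.toLinear _) = _
  rw [hf, map_neg, map_zsmul, hg, smul_neg, neg_neg, smul_smul, ssign_comm β α, ssign_mul_self,
    one_smul]

/-- The homomorphism `M ⊗ N → N ⊗ M`, `m ⊗ n ↦ −(−1)^{|m||n|}(n ⊗ m)`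
is an isomorphism of Lie superalgebras. -/
theorem statement5 {K : Type} [CommRing K] (M N : LieSuperalgebra K)
    (aMN : LieSuperAction M N) (aNM : LieSuperAction N M)
    (hcomp : AreCompatible aMN aNM) (hcomp' : AreCompatible aNM aMN)
    (T : LieSuperalgebra K) (ι : TensorData aMN aNM T) (hT : IsNATensor aMN aNM T ι)
    (T' : LieSuperalgebra K) (ι' : TensorData aNM aMN T') (hT' : IsNATensor aNM aMN T' ι') :
    ∃ f : LieSuperHom T T',
      (∀ (α β : ZMod 2) (m : M.grading α) (n : N.grading β),
        f.toLinear (ι.pair α β m n) = -(ssign α β • ι'.pair β α n m)) ∧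
      Function.Bijective f.toLinear := by
  obtain ⟨f, hf, -⟩ := hT T' ι'.swap
  obtain ⟨g, hg, -⟩ := hT' T ι.swap
  exact ⟨f, hf, Function.bijective_iff_has_inverse.mpr
    ⟨g.toLinear, hT.eq_id (g.comp f) (swap_swap_pair hf hg),
      hT'.eq_id (f.comp g) (swap_swap_pair hg hf)⟩⟩

end SuperNA
end
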